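/- For d ≥ 2, κ_i ≥ 0 (i = 1,…,d+1), n ∈ ℕ_0 and every polynomial f in d variables of degree at most n: ‖ √((1−|x|)/|x|) ⟨x,∇⟩f ‖_{κ,2}² + Σ_{1≤i<j≤d} ‖ (√(x_i x_j)/√|x|) ∂_{i,j} f ‖_{κ,2}² ≤ n(n+|κ|+d) ‖f‖_{κ,2}², and equality holds if and only if f belongs to V_n^d(W_κ). -/

import Mathlib

open MeasureTheory Finset

noncomputable section

/-- The simplex `△^d = {x : x_i ≥ 0, x_1 + ⋯ + x_d ≤ 1}`. -/
def Splx (d : ℕ) : Set (Fin d → ℝ) := {x | (∀ i, 0 ≤ x i) ∧ ∑ i, x i ≤ 1}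

/-- The `i`-th partial derivative. -/
def pd {d : ℕ} (i : Fin d) (f : (Fin d → ℝ) → ℝ) : (Fin d → ℝ) → ℝ :=
  fun x => fderiv ℝ f x (Pi.single i 1)

/-- `∂_{i,j} = ∂_i - ∂_j`. -/
def pdd {d : ℕ} (i j : Fin d) (f : (Fin d → ℝ) → ℝ) : (Fin d → ℝ) → ℝ :=
  fun x => pd i f x - pd j f x

/-- `⟨x,∇⟩ = ∑ x_i ∂_i`. -/
def xgrad {d : ℕ} (f : (Fin d → ℝ) → ℝ) : (Fin d → ℝ) → ℝ :=
  fun x => ∑ i, x i * pd i f x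

/-- The Jacobi weight `W_κ(x) = x_1^{κ_1} ⋯ x_d^{κ_d} (1-|x|)^{κ_{d+1}}`. -/
def Wk {d : ℕ} (κ : Fin (d+1) → ℝ) (x : Fin d → ℝ) : ℝ :=
  (∏ i : Fin d, x i ^ κ i.castSucc) * (1 - ∑ i, x i) ^ κ (Fin.last d)

/-- The spectral operator `D_κ`. -/
def Dk {d : ℕ} (κ : Fin (d+1) → ℝ) (f : (Fin d → ℝ) → ℝ) (x : Fin d → ℝ) : ℝ :=
  (∑ i, x i * (1 - x i) * pd i (pd i f) x)
    - 2 * ∑ i, ∑ j ∈ Finset.univ.filter (fun j => i < j), x i * x j * pd i (pd j f) x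
    + ∑ i, (κ i.castSucc + 1 - ((∑ k, κ k) + (d : ℝ) + 1) * x i) * pd i f x

/-- The normalizing constant `b_κ`. -/
def bk {d : ℕ} (κ : Fin (d+1) → ℝ) : ℝ :=
  Real.Gamma ((∑ i, κ i) + (d : ℝ) + 1) / ∏ i, Real.Gamma (κ i + 1)

/-- The inner product `⟨f,g⟩_κ = b_κ ∫_{△^d} f g W_κ`. -/
def ipk {d : ℕ} (κ : Fin (d+1) → ℝ) (f g : (Fin d → ℝ) → ℝ) : ℝ :=
  bk κ * ∫ x in Splx d, f x * g x * Wk κ x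

/-- The norm `‖f‖_{κ,2}`. -/
def nrm2 {d : ℕ} (κ : Fin (d+1) → ℝ) (f : (Fin d → ℝ) → ℝ) : ℝ :=
  Real.sqrt (ipk κ f f)

/-- Membership in `V_n^d(W_κ)`: a polynomial of degree (at most) `n` orthogonal to all
polynomials of lower degree. -/
def InVn (d n : ℕ) (κ : Fin (d+1) → ℝ) (f : MvPolynomial (Fin d) ℝ) : Prop :=
  f.totalDegree ≤ n ∧ ∀ g : MvPolynomial (Fin d) ℝ, g.totalDegree < n →
    ipk κ (fun x => MvPolynomial.eval x f) (fun x => MvPolynomial.eval x g) = 0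

/-- `x_k` for `1 ≤ k ≤ d+1`, with the convention `x_{d+1} = 1 - |x|`. -/
def xe {d : ℕ} (x : Fin d → ℝ) (k : Fin (d+1)) : ℝ :=
  if h : (k : ℕ) < d then x ⟨(k : ℕ), h⟩ else 1 - ∑ i, x i

/-- The quantity `‖√((1-|x|)/|x|) ⟨x,∇⟩f‖²_{κ,2} + Σ_{i<j} ‖(√(x_i x_j)/√|x|) ∂_{i,j} f‖²_{κ,2}`. -/
def cform {d : ℕ} (κ : Fin (d+1) → ℝ) (F : (Fin d → ℝ) → ℝ) : ℝ :=
  nrm2 κ (fun x => Real.sqrt ((1 - ∑ k, x k) / (∑ k, x k)) * xgrad F x) ^ 2 +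
  ∑ i, ∑ j ∈ Finset.univ.filter (fun j => i < j),
    nrm2 κ (fun x => Real.sqrt (x i * x j) / Real.sqrt (∑ k, x k) * pdd i j F x) ^ 2

open MvPolynomial in
/-- Evaluation of a polynomial has the formal gradient as its derivative. -/
lemma hasFDerivAt_eval {σ : Type*} [Fintype σ] (p : MvPolynomial σ ℝ) (x : σ → ℝ) :
    HasFDerivAt (fun y => eval y p)
      (∑ i, eval x (pderiv i p) • (ContinuousLinearMap.proj i : (σ → ℝ) →L[ℝ] ℝ)) x := by
  classical
  induction p using MvPolynomial.induction_on with
  | C a => simpa using hasFDerivAt_const a x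
  | add p q hp hq =>
    simp only [map_add, add_smul, Finset.sum_add_distrib]
    exact hp.add hq
  | mul_X p j hp =>
    have h := hp.mul (ContinuousLinearMap.proj (R := ℝ) (φ := fun _ : σ => ℝ) j).hasFDerivAt
    simp only [eval_mul, eval_X]
    refine h.congr_fderiv ?_
    simp only [pderiv_mul, pderiv_X, eval_add, eval_mul, eval_X, add_smul,
      Finset.sum_add_distrib, Finset.smul_sum, smul_smul]
    rw [add_comm]
    congr 1
    · exact Finset.sum_congr rfl fun i _ => by simp [mul_comm]
    · rw [Finset.sum_eq_single j] <;> simp +contextual [eq_comm]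

open MvPolynomial in
lemma pd_eval {d : ℕ} (i : Fin d) (p : MvPolynomial (Fin d) ℝ) (x : Fin d → ℝ) :
    pd i (fun y => eval y p) x = eval x (pderiv i p) := by
  rw [pd, (hasFDerivAt_eval p x).fderiv]
  simp [Pi.single_apply]

lemma isCompact_Splx (d : ℕ) : IsCompact (Splx d) := by
  refine (isCompact_univ_pi fun _ : Fin d => isCompact_Icc (a := (0 : ℝ)) (b := 1)).of_isClosed_subset
    ?_ ?_
  · simp only [Splx, Set.ofPred_and, Set.ofPred_forall]
    exact (isClosed_iInter fun i => isClosed_le continuous_const (continuous_apply i)).inter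
      (isClosed_le (by fun_prop) continuous_const)
  · intro x hx i _
    exact ⟨hx.1 i, (Finset.single_le_sum (fun j _ => hx.1 j) (Finset.mem_univ i)).trans hx.2⟩

lemma continuous_Wk {d : ℕ} {κ : Fin (d + 1) → ℝ} (hκ : ∀ i, 0 ≤ κ i) : Continuous (Wk κ) := by
  unfold Wk
  refine (continuous_finsetProd _ fun i _ => ?_).mul ?_
  · exact (Real.continuous_rpow_const (hκ _)).comp (continuous_apply i)
  · exact (Real.continuous_rpow_const (hκ _)).comp (by fun_prop)

lemma Wk_nonneg {d : ℕ} (κ : Fin (d + 1) → ℝ) {x : Fin d → ℝ} (hx : x ∈ Splx d) : 0 ≤ Wk κ x :=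
  mul_nonneg (Finset.prod_nonneg fun i _ => Real.rpow_nonneg (hx.1 i) _)
    (Real.rpow_nonneg (sub_nonneg.2 hx.2) _)

open MvPolynomial in
lemma continuous_eval_mul_Wk {d : ℕ} {κ : Fin (d + 1) → ℝ} (hκ : ∀ i, 0 ≤ κ i)
    (p : MvPolynomial (Fin d) ℝ) : Continuous fun x => eval x p * Wk κ x :=
  (continuous_eval p).mul (continuous_Wk hκ)

open MvPolynomial in
lemma integrableOn_eval_mul_Wk {d : ℕ} {κ : Fin (d + 1) → ℝ} (hκ : ∀ i, 0 ≤ κ i)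
    (p : MvPolynomial (Fin d) ℝ) : IntegrableOn (fun x => eval x p * Wk κ x) (Splx d) :=
  (continuous_eval_mul_Wk hκ p).continuousOn.integrableOn_compact (isCompact_Splx d)

open MvPolynomial in
/-- Integration of polynomials against the Jacobi weight on the simplex. -/
def jacobiIntegral {d : ℕ} {κ : Fin (d + 1) → ℝ} (hκ : ∀ i, 0 ≤ κ i) :
    MvPolynomial (Fin d) ℝ →ₗ[ℝ] ℝ where
  toFun p := ∫ x in Splx d, eval x p * Wk κ x
  map_add' p q := by
    simp only [eval_add, add_mul]
    exact integral_add (integrableOn_eval_mul_Wk hκ p) (integrableOn_eval_mul_Wk hκ q)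
  map_smul' a p := by
    simp only [smul_eval, mul_assoc, RingHom.id_apply, smul_eq_mul]
    exact integral_const_mul a _

open MvPolynomial in
lemma jacobiIntegral_apply {d : ℕ} {κ : Fin (d + 1) → ℝ} (hκ : ∀ i, 0 ≤ κ i)
    (p : MvPolynomial (Fin d) ℝ) :
    jacobiIntegral hκ p = ∫ x in Splx d, eval x p * Wk κ x := rfl

open MvPolynomial in
lemma jacobiIntegral_mul_self_nonneg {d : ℕ} {κ : Fin (d + 1) → ℝ} (hκ : ∀ i, 0 ≤ κ i)
    (p : MvPolynomial (Fin d) ℝ) : 0 ≤ jacobiIntegral hκ (p * p) := by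
  rw [jacobiIntegral_apply]
  refine setIntegral_nonneg (isCompact_Splx d).measurableSet fun x hx => ?_
  rw [eval_mul]
  exact mul_nonneg (mul_self_nonneg _) (Wk_nonneg κ hx)

open MvPolynomial in
lemma eq_zero_of_jacobiIntegral_mul_self {d : ℕ} {κ : Fin (d + 1) → ℝ} (hκ : ∀ i, 0 ≤ κ i)
    {p : MvPolynomial (Fin d) ℝ} (hp : jacobiIntegral hκ (p * p) = 0) : p = 0 := by
  set U : Set (Fin d → ℝ) := Set.univ.pi fun _ => Set.Ioo 0 (1 / (d + 1) : ℝ) with hU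
  have hd : (0 : ℝ) < d + 1 := by positivity
  have hsum : ∀ x ∈ U, ∑ i, x i < 1 := by
    intro x hx
    calc ∑ i, x i ≤ ∑ _i : Fin d, (1 / (d + 1) : ℝ) :=
          Finset.sum_le_sum fun i _ => (hx i trivial).2.le
      _ = d / (d + 1) := by simp [div_eq_mul_inv]
      _ < 1 := by rw [div_lt_one hd]; linarith
  have hUS : U ⊆ Splx d := fun x hx => ⟨fun i => (hx i trivial).1.le, (hsum x hx).le⟩
  have hUo : IsOpen U := isOpen_set_pi Set.finite_univ fun _ _ => isOpen_Ioo
  rw [jacobiIntegral_apply, setIntegral_eq_zero_iff_of_nonneg_ae _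
    (integrableOn_eval_mul_Wk hκ _)] at hp
  · have hae := ae_restrict_of_ae_restrict_of_subset hUS hp
    have heq := Measure.eqOn_open_of_ae_eq hae hUo (continuous_eval_mul_Wk hκ _).continuousOn
      continuousOn_const
    refine funext_set (fun _ => Set.Ioo 0 (1 / (d + 1) : ℝ))
      (fun _ => Set.Ioo_infinite (by positivity)) fun x hx => ?_
    have h := heq hx
    have hW : 0 < Wk κ x :=
      mul_pos (Finset.prod_pos fun i _ => Real.rpow_pos_of_pos (hx i trivial).1 _)
        (Real.rpow_pos_of_pos (sub_pos.2 (hsum x hx)) _)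
    simpa [hW.ne'] using h
  · filter_upwards [ae_restrict_mem (isCompact_Splx d).measurableSet] with x hx
    rw [eval_mul]
    exact mul_nonneg (mul_self_nonneg _) (Wk_nonneg κ hx)

/-- The one-variable integration by parts behind `jacobiIntegral_one_sub_sum_mul_eq`. -/
lemma intervalIntegral_beta_parts {a c s : ℝ} (ha : 0 ≤ a) (hc : 0 ≤ c) (hs : 0 ≤ s)
    {v v' : ℝ → ℝ} (hv : ∀ t, HasDerivAt v (v' t) t) (hv' : Continuous v') :
    ∫ t in (0 : ℝ)..s, ((s - t) * (t * v' t + (a + 1) * v t) - (c + 1) * (t * v t)) *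
      (t ^ a * (s - t) ^ c) = 0 := by
  have hvc : Continuous v := continuous_iff_continuousAt.2 fun t => (hv t).continuousAt
  have hpow : ∀ b : ℝ, 0 ≤ b → Continuous fun t : ℝ => (s - t) ^ b := fun b hb =>
    (Real.continuous_rpow_const hb).comp (by fun_prop)
  have h := intervalIntegral.integral_eq_sub_of_hasDerivAt_of_le
    (f := fun t => v t * (t ^ (a + 1) * (s - t) ^ (c + 1)))
    (f' := fun t => ((s - t) * (t * v' t + (a + 1) * v t) - (c + 1) * (t * v t)) *
      (t ^ a * (s - t) ^ c)) hs ?_ ?_ ?_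
  · rw [h, sub_self, Real.zero_rpow (by linarith), Real.zero_rpow (by linarith)]
    ring
  · exact (hvc.mul ((Real.continuous_rpow_const (by linarith)).mul
      (hpow _ (by linarith)))).continuousOn
  · rintro t ⟨ht0, hts⟩
    have hst : 0 < s - t := sub_pos.2 hts
    have h1 := Real.hasDerivAt_rpow_const (x := t) (p := a + 1) (Or.inl ht0.ne')
    have h2 := ((hasDerivAt_id t).const_sub s).rpow_const (p := c + 1) (Or.inl hst.ne')
    refine ((hv t).mul (h1.mul h2)).congr_deriv ?_
    simp only [id, add_sub_cancel_right, Real.rpow_add_one ht0.ne', Real.rpow_add_one hst.ne']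
    simp only [Pi.mul_apply, Real.rpow_add_one ht0.ne', Real.rpow_add_one hst.ne']
    ring
  · refine Continuous.intervalIntegrable ?_ _ _
    have := hpow c hc
    have := Real.continuous_rpow_const ha
    fun_prop

open MvPolynomial in
/-- Integration by parts in the direction of the `i`-th coordinate axis. -/
lemma jacobiIntegral_one_sub_sum_mul_eq {d : ℕ} {κ : Fin (d + 1) → ℝ} (hκ : ∀ i, 0 ≤ κ i)
    (i : Fin d) (u : MvPolynomial (Fin d) ℝ) :
    jacobiIntegral hκ ((1 - ∑ j, X j) * (X i * pderiv i u + C (κ i.castSucc + 1) * u)) =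
      (κ (Fin.last d) + 1) * jacobiIntegral hκ (X i * u) := by
  rw [← smul_eq_mul (κ (Fin.last d) + 1), ← map_smul, ← sub_eq_zero, ← map_sub, jacobiIntegral_apply]
  set p := (1 - ∑ j, X j) * (X i * pderiv i u + C (κ i.castSucc + 1) * u) -
    (κ (Fin.last d) + 1) • (X i * u) with hp
  have hint := integrableOn_eval_mul_Wk hκ p
  have hms := (isCompact_Splx d).measurableSet
  rw [← integrable_indicator_iff hms] at hint
  rw [← integral_indicator hms]
  obtain _ | m := d
  · exact i.elim0
  have hmp := (volume_preserving_piFinSuccAbove (fun _ : Fin (m + 1) => ℝ) i).symm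
  rw [← hmp.integral_comp']
  rw [Measure.volume_eq_prod, integral_prod_symm]
  swap
  · exact hmp.integrable_comp_of_integrable hint
  refine integral_eq_zero_of_ae (Filter.Eventually.of_forall fun y => ?_)
  have hsymm : ∀ t, (MeasurableEquiv.piFinSuccAbove (fun _ : Fin (m + 1) => ℝ) i).symm (t, y) =
    i.insertNth t y := fun t => rfl
  simp only [hsymm, Pi.zero_apply]
  by_cases hy : (∀ j, 0 ≤ y j) ∧ ∑ j, y j ≤ 1
  swap
  · refine integral_eq_zero_of_ae (Filter.Eventually.of_forall fun t => ?_)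
    refine Set.indicator_of_notMem (fun hmem => hy ⟨fun j => ?_, ?_⟩) _
    · simpa using hmem.1 (i.succAbove j)
    · have h0 := hmem.1 i
      have h1 := hmem.2
      rw [Fin.sum_univ_succAbove _ i] at h1
      simp only [Fin.insertNth_apply_same, Fin.insertNth_apply_succAbove] at h0 h1
      linarith
  set s := 1 - ∑ j, y j with hs
  have hs0 : 0 ≤ s := sub_nonneg.2 hy.2
  have hmem : ∀ t, i.insertNth t y ∈ Splx (m + 1) ↔ t ∈ Set.Icc 0 s := by
    intro t
    simp only [Splx, Set.mem_ofPred_eq, Fin.forall_iff_succAbove i, Fin.sum_univ_succAbove _ i,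
      Fin.insertNth_apply_same, Fin.insertNth_apply_succAbove, Set.mem_Icc]
    constructor
    · rintro ⟨⟨h1, -⟩, h2⟩
      exact ⟨h1, by linarith⟩
    · rintro ⟨h1, h2⟩
      exact ⟨⟨h1, hy.1⟩, by linarith⟩
  have hline : ∀ t, HasDerivAt (fun t : ℝ => (i.insertNth t y : Fin (m + 1) → ℝ))
      (Pi.single i 1) t := by
    intro t
    rw [hasDerivAt_pi, Fin.forall_iff_succAbove i]
    refine ⟨by simpa using hasDerivAt_id' t, fun j => ?_⟩
    simpa using hasDerivAt_const t (y j)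
  have hderiv : ∀ t, HasDerivAt (fun t : ℝ => eval (i.insertNth t y : Fin (m + 1) → ℝ) u)
      (eval (i.insertNth t y : Fin (m + 1) → ℝ) (pderiv i u)) t := by
    intro t
    refine ((hasFDerivAt_eval u _).comp_hasDerivAt t (hline t)).congr_deriv ?_
    simp [Pi.single_apply]
  have hcont : Continuous fun t : ℝ => eval (i.insertNth t y : Fin (m + 1) → ℝ) (pderiv i u) :=
    (continuous_eval _).comp
      (continuous_iff_continuousAt.2 fun t => (hline t).continuousAt)
  have hbeta := intervalIntegral_beta_parts (hκ i.castSucc) (hκ (Fin.last _)) hs0 hderiv hcont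
  calc _ = ∫ t in Set.Icc 0 s, eval (i.insertNth t y) p * Wk κ (i.insertNth t y) := by
        rw [← integral_indicator measurableSet_Icc]
        congr 1 with t
        simp only [Set.indicator, hmem]
    _ = ∫ t in (0 : ℝ)..s, (∏ j : Fin m, y j ^ κ (i.succAbove j).castSucc) * _ := by
        rw [integral_Icc_eq_integral_Ioc, ← intervalIntegral.integral_of_le hs0]
        refine intervalIntegral.integral_congr fun t _ => ?_
        have hsub : (1 : ℝ) - (t + ∑ j, y j) = s - t := by rw [hs]; ring
        simp only [hp, Wk, eval_sub, eval_mul, eval_add, map_sum, eval_X, eval_C, map_one,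
          smul_eval, Fin.sum_univ_succAbove _ i, Fin.prod_univ_succAbove _ i,
          Fin.insertNth_apply_same, Fin.insertNth_apply_succAbove, hsub]
        rw [mul_comm (t ^ κ i.castSucc), mul_assoc (∏ j : Fin m, y j ^ κ (i.succAbove j).castSucc),
          mul_left_comm]
    _ = 0 := by rw [intervalIntegral.integral_const_mul, hbeta, mul_zero]

open MvPolynomial in
lemma pderiv_pderiv_comm {σ : Type*} (i j : σ) (u : MvPolynomial σ ℝ) :
    pderiv i (pderiv j u) = pderiv j (pderiv i u) := by
  classical
  have h : ⁅(pderiv i : Derivation ℝ (MvPolynomial σ ℝ) _), pderiv j⁆ = 0 :=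
    derivation_ext fun k => by
      rw [Derivation.commutator_apply, pderiv_X, pderiv_X, Pi.single_apply, Pi.single_apply]
      split_ifs <;> simp
  exact sub_eq_zero.1 ((Derivation.commutator_apply ..).symm.trans (congrArg (fun D => D u) h))

open MvPolynomial in
/-- The operator `u ↦ x_i^{-κ_i} ∂_i (x_i^{κ_i + 1} u)`. -/
def weightedPartial {d : ℕ} (κ : Fin (d + 1) → ℝ) (i : Fin d) (u : MvPolynomial (Fin d) ℝ) :
    MvPolynomial (Fin d) ℝ :=
  X i * pderiv i u + C (κ i.castSucc + 1) * u

open MvPolynomial in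
lemma weightedPartial_mul {d : ℕ} (κ : Fin (d + 1) → ℝ) (i : Fin d)
    (u g : MvPolynomial (Fin d) ℝ) :
    weightedPartial κ i (u * g) = weightedPartial κ i u * g + X i * pderiv i g * u := by
  simp only [weightedPartial, pderiv_mul]
  ring

open MvPolynomial in
lemma weightedPartial_comm {d : ℕ} (κ : Fin (d + 1) → ℝ) (i j : Fin d)
    (u : MvPolynomial (Fin d) ℝ) :
    weightedPartial κ i (weightedPartial κ j u) = weightedPartial κ j (weightedPartial κ i u) := by
  obtain rfl | hij := eq_or_ne i j
  · rfl
  · simp only [weightedPartial, map_add, pderiv_mul, pderiv_C, pderiv_X_of_ne hij,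
      pderiv_X_of_ne hij.symm, pderiv_pderiv_comm i j u]
    ring

open MvPolynomial in
/-- The operator `u ↦ W_κ^{-1} div (W_κ x_i (e_i - x) u)`. -/
def weightedDivergence {d : ℕ} (κ : Fin (d + 1) → ℝ) (i : Fin d) (u : MvPolynomial (Fin d) ℝ) :
    MvPolynomial (Fin d) ℝ :=
  weightedPartial κ i u - X i * (∑ j, weightedPartial κ j u + C (κ (Fin.last d) + 1) * u)

open MvPolynomial in
lemma weightedDivergence_mul {d : ℕ} (κ : Fin (d + 1) → ℝ) (i : Fin d)
    (u g : MvPolynomial (Fin d) ℝ) :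
    weightedDivergence κ i (u * g) =
      weightedDivergence κ i u * g + X i * u * (pderiv i g - ∑ j, X j * pderiv j g) := by
  simp only [weightedDivergence, weightedPartial_mul, Finset.sum_add_distrib, ← Finset.sum_mul]
  ring

open MvPolynomial in
lemma jacobiIntegral_weightedDivergence {d : ℕ} {κ : Fin (d + 1) → ℝ} (hκ : ∀ i, 0 ≤ κ i)
    (i : Fin d) (u : MvPolynomial (Fin d) ℝ) :
    jacobiIntegral hκ (weightedDivergence κ i u) = 0 := by
  have hc : κ (Fin.last d) + 1 ≠ 0 := by linarith [hκ (Fin.last d)]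
  have key : ∀ (j : Fin d) (v : MvPolynomial (Fin d) ℝ),
      jacobiIntegral hκ ((1 - ∑ j, X j) * weightedPartial κ j v) =
        (κ (Fin.last d) + 1) * jacobiIntegral hκ (X j * v) :=
    jacobiIntegral_one_sub_sum_mul_eq hκ
  have h1 := key i u
  have h2 : ∀ j, (κ (Fin.last d) + 1) * jacobiIntegral hκ (X i * weightedPartial κ j u) =
      (κ (Fin.last d) + 1) * jacobiIntegral hκ (X j * weightedPartial κ i u) := fun j => by
    rw [← key, ← key, weightedPartial_comm]
  have h2 := fun j => mul_left_cancel₀ hc (h2 j)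
  have h3 : jacobiIntegral hκ ((1 - ∑ j, X j) * weightedPartial κ i u) =
      jacobiIntegral hκ (weightedPartial κ i u) -
        ∑ j, jacobiIntegral hκ (X j * weightedPartial κ i u) := by
    rw [sub_mul, one_mul, Finset.sum_mul, map_sub, map_sum]
  have h4 : weightedDivergence κ i u = weightedPartial κ i u -
      (∑ j, X i * weightedPartial κ j u + (κ (Fin.last d) + 1) • (X i * u)) := by
    rw [weightedDivergence, smul_eq_C_mul, mul_add, Finset.mul_sum]
    ring
  rw [h4, map_sub, map_add, map_sum, map_smul, smul_eq_mul, Finset.sum_congr rfl fun j _ => h2 j]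
  linarith

open MvPolynomial in
/-- The second order differential operator of the Jacobi polynomials on the simplex, with the sign
making it nonnegative. -/
def jacobiOperator {d : ℕ} (κ : Fin (d + 1) → ℝ) (f : MvPolynomial (Fin d) ℝ) :
    MvPolynomial (Fin d) ℝ :=
  -∑ i, weightedDivergence κ i (pderiv i f)

open MvPolynomial in
/-- The carré du champ of the Jacobi operator on the simplex. -/
def carreDuChamp {d : ℕ} (f g : MvPolynomial (Fin d) ℝ) : MvPolynomial (Fin d) ℝ :=
  ∑ i, X i * pderiv i f * pderiv i g - (∑ i, X i * pderiv i f) * ∑ i, X i * pderiv i g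

lemma carreDuChamp_comm {d : ℕ} (f g : MvPolynomial (Fin d) ℝ) :
    carreDuChamp f g = carreDuChamp g f := by
  simp only [carreDuChamp, mul_right_comm _ (MvPolynomial.pderiv _ f)]
  rw [mul_comm (∑ i, MvPolynomial.X i * MvPolynomial.pderiv i f)]

open MvPolynomial in
lemma jacobiIntegral_jacobiOperator_mul {d : ℕ} {κ : Fin (d + 1) → ℝ} (hκ : ∀ i, 0 ≤ κ i)
    (f g : MvPolynomial (Fin d) ℝ) :
    jacobiIntegral hκ (jacobiOperator κ f * g) = jacobiIntegral hκ (carreDuChamp f g) := by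
  have h : ∑ i, weightedDivergence κ i (pderiv i f * g) =
      carreDuChamp f g - jacobiOperator κ f * g := by
    simp only [weightedDivergence_mul, Finset.sum_add_distrib, mul_sub, Finset.sum_sub_distrib,
      ← Finset.sum_mul, carreDuChamp, jacobiOperator]
    ring
  have h0 := congrArg (jacobiIntegral hκ) h
  rw [map_sum, Finset.sum_eq_zero fun i _ => jacobiIntegral_weightedDivergence hκ i _,
    map_sub] at h0
  linarith

lemma jacobiIntegral_jacobiOperator_mul_comm {d : ℕ} {κ : Fin (d + 1) → ℝ} (hκ : ∀ i, 0 ≤ κ i)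
    (f g : MvPolynomial (Fin d) ℝ) :
    jacobiIntegral hκ (jacobiOperator κ f * g) = jacobiIntegral hκ (f * jacobiOperator κ g) := by
  rw [mul_comm f, jacobiIntegral_jacobiOperator_mul, jacobiIntegral_jacobiOperator_mul,
    carreDuChamp_comm]

open MvPolynomial in
lemma coeff_X_mul_pderiv {σ : Type*} (i : σ) (f : MvPolynomial σ ℝ) (m : σ →₀ ℕ) :
    coeff m (X i * pderiv i f) = m i * coeff m f := by
  classical
  induction f using MvPolynomial.induction_on' with
  | monomial k a =>
    rw [X_mul_pderiv_monomial, coeff_smul, coeff_monomial]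
    split_ifs with h
    · rw [h, nsmul_eq_mul]
    · simp
  | add p q hp hq => rw [map_add, mul_add, coeff_add, coeff_add, hp, hq, mul_add]

open MvPolynomial in
lemma coeff_weightedPartial {d : ℕ} (κ : Fin (d + 1) → ℝ) (i : Fin d)
    (u : MvPolynomial (Fin d) ℝ) (m : Fin d →₀ ℕ) :
    coeff m (weightedPartial κ i u) = (m i + κ i.castSucc + 1) * coeff m u := by
  rw [weightedPartial, coeff_add, coeff_X_mul_pderiv, coeff_C_mul]
  ring

open MvPolynomial in
lemma coeff_X_mul_weightedPartial {d : ℕ} (κ : Fin (d + 1) → ℝ) (i : Fin d)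
    (f : MvPolynomial (Fin d) ℝ) (m : Fin d →₀ ℕ) :
    coeff m (X i * (∑ j, weightedPartial κ j (pderiv i f) +
      C (κ (Fin.last d) + 1) * pderiv i f)) =
      m i * (m.degree + (∑ k, κ k) + d) * coeff m f := by
  by_cases hi : i ∈ m.support
  · rw [coeff_X_mul', if_pos hi, coeff_add, coeff_sum, coeff_C_mul]
    have hmi : 1 ≤ m i := Nat.one_le_iff_ne_zero.2 (Finsupp.mem_support_iff.1 hi)
    have hle : Finsupp.single i 1 ≤ m := Finsupp.single_le_iff.2 hmi
    simp only [coeff_weightedPartial, ← Finset.sum_mul]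
    have hdeg : (m.degree : ℝ) = ∑ j, ((m - Finsupp.single i 1 : Fin d →₀ ℕ) j : ℝ) + 1 := by
      conv_lhs => rw [← tsub_add_cancel_of_le hle]
      rw [map_add, Finsupp.degree_single, Nat.cast_add, Finsupp.degree_eq_sum]
      push_cast
      rfl
    rw [coeff_pderiv, tsub_add_cancel_of_le hle]
    simp only [Finset.sum_add_distrib, Finset.sum_const, Finset.card_univ, Fintype.card_fin,
      nsmul_eq_mul, mul_one, hdeg, Fin.sum_univ_castSucc]
    have : ((m - Finsupp.single i 1 : Fin d →₀ ℕ) i : ℝ) = m i - 1 := by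
      simp [Nat.cast_sub hmi]
    rw [this]
    ring
  · rw [coeff_X_mul', if_neg hi, Finsupp.notMem_support_iff.1 hi]
    simp

open MvPolynomial in
lemma totalDegree_jacobiOperator_sub_lt {d n : ℕ} (κ : Fin (d + 1) → ℝ)
    {f : MvPolynomial (Fin d) ℝ} (hf : f.totalDegree ≤ n) (hn : 0 < n) :
    (jacobiOperator κ f - ((n : ℝ) * (n + (∑ k, κ k) + d)) • f).totalDegree < n := by
  have hvan : ∀ m : Fin d →₀ ℕ, n < m.degree → coeff m f = 0 := fun m hm =>
    coeff_eq_zero_of_totalDegree_lt (by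
      rw [Finsupp.degree_apply] at hm
      exact hf.trans_lt hm)
  rw [totalDegree, Finset.sup_lt_iff hn]
  intro m hm
  by_contra! hlt
  change n ≤ m.degree at hlt
  refine mem_support_iff.1 hm ?_
  have h1 : ∀ i, coeff m (weightedPartial κ i (pderiv i f)) = 0 := fun i => by
    rw [coeff_weightedPartial, coeff_pderiv, hvan, zero_mul, mul_zero]
    rw [map_add, Finsupp.degree_single]
    omega
  simp only [jacobiOperator, weightedDivergence, Finset.sum_sub_distrib, coeff_sub, coeff_neg,
    coeff_sum, coeff_smul, h1, coeff_X_mul_weightedPartial, ← Finset.sum_mul, smul_eq_mul,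
    Finset.sum_const_zero]
  have hdeg : ∑ i, (m i : ℝ) = m.degree := by
    rw [Finsupp.degree_eq_sum]
    push_cast
    rfl
  rw [hdeg]
  obtain h | h := hlt.eq_or_lt
  · rw [← h]
    ring
  · rw [hvan m h]
    ring

open MvPolynomial in
lemma totalDegree_jacobiOperator_lt {d n : ℕ} (κ : Fin (d + 1) → ℝ)
    {f : MvPolynomial (Fin d) ℝ} (hf : f.totalDegree < n) :
    (jacobiOperator κ f).totalDegree < n := by
  have h := totalDegree_jacobiOperator_sub_lt κ hf.le (by omega)
  rw [← sub_add_cancel (jacobiOperator κ f) (((n : ℝ) * (n + (∑ k, κ k) + d)) • f)]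
  exact (totalDegree_add _ _).trans_lt (max_lt h ((totalDegree_smul_le _ _).trans_lt hf))

open MvPolynomial in
lemma exists_orthogonal_decomposition {d : ℕ} {κ : Fin (d + 1) → ℝ} (hκ : ∀ i, 0 ≤ κ i) (m : ℕ)
    (f : MvPolynomial (Fin d) ℝ) :
    ∃ q : MvPolynomial (Fin d) ℝ, q.totalDegree ≤ m ∧
      ∀ g : MvPolynomial (Fin d) ℝ, g.totalDegree ≤ m → jacobiIntegral hκ ((f - q) * g) = 0 := by
  let V := restrictTotalDegree (Fin d) ℝ m
  let B : MvPolynomial (Fin d) ℝ →ₗ[ℝ] Module.Dual ℝ V :=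
    ((LinearMap.mul ℝ (MvPolynomial (Fin d) ℝ)).compr₂ (jacobiIntegral hκ)).compl₂ V.subtype
  have hB : ∀ p (g : V), B p g = jacobiIntegral hκ (p * g) := fun _ _ => rfl
  have hinj : Function.Injective (B.comp V.subtype) := by
    rw [← LinearMap.ker_eq_bot, LinearMap.ker_eq_bot']
    intro q hq
    exact Subtype.ext (eq_zero_of_jacobiIntegral_mul_self hκ (by
      simpa [hB] using congrArg (fun φ => φ q) hq))
  obtain ⟨q, hq⟩ := (LinearMap.injective_iff_surjective_of_finrank_eq_finrank
    Subspace.dual_finrank_eq.symm).1 hinj (B f)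
  refine ⟨q, (mem_restrictTotalDegree _ _ _).1 q.2, fun g hg => ?_⟩
  have h := congrArg (fun φ => φ ⟨g, (mem_restrictTotalDegree _ _ _).2 hg⟩) hq
  simp only [LinearMap.comp_apply, Submodule.subtype_apply, hB] at h
  rw [sub_mul, map_sub, h, sub_self]

open MvPolynomial in
lemma jacobiIntegral_jacobiOperator_mul_self_of_orthogonal {d n : ℕ} {κ : Fin (d + 1) → ℝ}
    (hκ : ∀ i, 0 ≤ κ i) (hn : 0 < n) {p : MvPolynomial (Fin d) ℝ} (hp : p.totalDegree ≤ n)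
    (horth : ∀ g : MvPolynomial (Fin d) ℝ, g.totalDegree < n → jacobiIntegral hκ (p * g) = 0) :
    jacobiIntegral hκ (p * jacobiOperator κ p) =
      n * (n + (∑ k, κ k) + d) * jacobiIntegral hκ (p * p) := by
  have h := horth _ (totalDegree_jacobiOperator_sub_lt κ hp hn)
  rw [mul_sub, mul_smul_comm, map_sub, map_smul, smul_eq_mul] at h
  linarith

open MvPolynomial in
lemma jacobiOperator_add {d : ℕ} (κ : Fin (d + 1) → ℝ) (f g : MvPolynomial (Fin d) ℝ) :
    jacobiOperator κ (f + g) = jacobiOperator κ f + jacobiOperator κ g := by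
  simp only [jacobiOperator, weightedDivergence, weightedPartial, map_add, mul_add,
    Finset.sum_add_distrib, Finset.sum_sub_distrib]
  ring

open MvPolynomial in
/-- The spectral bound for the Jacobi operator on polynomials of degree at most `n`. -/
lemma jacobiIntegral_mul_jacobiOperator_le {d : ℕ} {κ : Fin (d + 1) → ℝ} (hκ : ∀ i, 0 ≤ κ i)
    (n : ℕ) {f : MvPolynomial (Fin d) ℝ} (hf : f.totalDegree ≤ n) :
    jacobiIntegral hκ (f * jacobiOperator κ f) ≤
        n * (n + (∑ k, κ k) + d) * jacobiIntegral hκ (f * f) ∧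
      (jacobiIntegral hκ (f * jacobiOperator κ f) =
          n * (n + (∑ k, κ k) + d) * jacobiIntegral hκ (f * f) ↔
        ∀ g : MvPolynomial (Fin d) ℝ, g.totalDegree < n → jacobiIntegral hκ (f * g) = 0) := by
  induction n generalizing f with
  | zero =>
    obtain ⟨a, rfl⟩ : ∃ a, f = C a := ⟨_, totalDegree_eq_zero_iff_eq_C.1 (Nat.le_zero.1 hf)⟩
    have h : jacobiOperator κ (C a) = 0 := by
      simp [jacobiOperator, weightedDivergence, weightedPartial]
    simp [h]
  | succ m ih =>
    obtain ⟨q, hq, horth⟩ := exists_orthogonal_decomposition hκ m f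
    set p := f - q with hp
    have hpn : p.totalDegree ≤ m + 1 :=
      (totalDegree_sub _ _).trans (max_le hf (by omega))
    have hfpq : f = p + q := (sub_add_cancel f q).symm
    have hS : 0 ≤ ∑ k, κ k := Finset.sum_nonneg fun k _ => hκ k
    have hpp := jacobiIntegral_jacobiOperator_mul_self_of_orthogonal hκ m.succ_pos hpn
      fun g hg => horth g (by omega)
    have hpq : jacobiIntegral hκ (p * q) = 0 := horth q hq
    have hpLq : jacobiIntegral hκ (p * jacobiOperator κ q) = 0 :=
      horth _ (Nat.lt_succ_iff.1 (totalDegree_jacobiOperator_lt κ (Nat.lt_succ_iff.2 hq)))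
    have hqLp : jacobiIntegral hκ (q * jacobiOperator κ p) = 0 := by
      rw [← jacobiIntegral_jacobiOperator_mul_comm, mul_comm, hpLq]
    have hqq := (ih hq).1
    have hq0 := jacobiIntegral_mul_self_nonneg hκ q
    have hL : jacobiIntegral hκ (f * jacobiOperator κ f) =
        jacobiIntegral hκ (p * jacobiOperator κ p) + jacobiIntegral hκ (q * jacobiOperator κ q) := by
      rw [hfpq, jacobiOperator_add, add_mul, mul_add, mul_add, map_add, map_add, map_add, hpLq,
        hqLp]
      ring
    have hN : jacobiIntegral hκ (f * f) =
        jacobiIntegral hκ (p * p) + jacobiIntegral hκ (q * q) := by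
      rw [hfpq, add_mul, mul_add, mul_add, map_add, map_add, map_add, mul_comm q p, hpq]
      ring
    have hm : (0 : ℝ) ≤ m := m.cast_nonneg
    have hd : (0 : ℝ) ≤ d := d.cast_nonneg
    have hgap : (m : ℝ) * (m + (∑ k, κ k) + d) * jacobiIntegral hκ (q * q) +
        jacobiIntegral hκ (q * q) ≤
        ((m + 1 : ℕ) : ℝ) * ((m + 1 : ℕ) + (∑ k, κ k) + d) * jacobiIntegral hκ (q * q) := by
      rw [← add_one_mul]
      refine mul_le_mul_of_nonneg_right ?_ hq0
      push_cast
      nlinarith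
    refine ⟨?_, fun heq => ?_, fun h =>
      jacobiIntegral_jacobiOperator_mul_self_of_orthogonal hκ m.succ_pos hf h⟩
    · rw [hL, hN, hpp, mul_add]
      linarith
    · rw [hL, hN, hpp, mul_add] at heq
      have hq' : q = 0 := eq_zero_of_jacobiIntegral_mul_self hκ (by linarith)
      rw [hfpq, hq', add_zero]
      exact fun g hg => horth g (by omega)

/-- The Lagrange identity with weights. -/
lemma sum_sum_lt_mul_sq_sub {ι : Type*} [Fintype ι] [LinearOrder ι] (x a : ι → ℝ) :
    ∑ i, ∑ j ∈ Finset.univ.filter (fun j => i < j), x i * x j * (a i - a j) ^ 2 =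
      (∑ i, x i) * ∑ i, x i * a i * a i - (∑ i, x i * a i) ^ 2 := by
  have hsplit : ∑ i, ∑ j, x i * x j * (a i - a j) ^ 2 =
      2 * ∑ i, ∑ j ∈ Finset.univ.filter (fun j => i < j), x i * x j * (a i - a j) ^ 2 := by
    simp only [Finset.sum_filter]
    have hswap : ∑ i, ∑ j, (if j < i then x i * x j * (a i - a j) ^ 2 else 0) =
        ∑ i, ∑ j, if i < j then x i * x j * (a i - a j) ^ 2 else 0 := by
      rw [Finset.sum_comm]
      refine Finset.sum_congr rfl fun i _ => Finset.sum_congr rfl fun j _ => ?_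
      split_ifs <;> ring
    rw [two_mul]
    nth_rewrite 2 [← hswap]
    simp only [← Finset.sum_add_distrib]
    refine Finset.sum_congr rfl fun i _ => Finset.sum_congr rfl fun j _ => ?_
    obtain h | rfl | h := lt_trichotomy i j
    · simp [h, h.not_gt]
    · simp
    · simp [h, h.not_gt]
  have hexp : ∑ i, ∑ j, x i * x j * (a i - a j) ^ 2 =
      2 * ((∑ i, x i) * ∑ i, x i * a i * a i - (∑ i, x i * a i) ^ 2) := by
    have h : ∀ i j, x i * x j * (a i - a j) ^ 2 =
        x i * a i * a i * x j + x i * (x j * a j * a j) - 2 * (x i * a i * (x j * a j)) :=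
      fun i j => by ring
    simp only [h, Finset.sum_add_distrib, Finset.sum_sub_distrib, ← Finset.mul_sum,
      ← Finset.sum_mul]
    ring
  linarith

lemma bk_pos {d : ℕ} {κ : Fin (d + 1) → ℝ} (hκ : ∀ i, 0 ≤ κ i) : 0 < bk κ := by
  have hS : 0 ≤ ∑ k, κ k := Finset.sum_nonneg fun k _ => hκ k
  exact div_pos (Real.Gamma_pos_of_pos (by positivity))
    (Finset.prod_pos fun i _ => Real.Gamma_pos_of_pos (by linarith [hκ i]))

lemma nrm2_sq {d : ℕ} {κ : Fin (d + 1) → ℝ} (hκ : ∀ i, 0 ≤ κ i) (F : (Fin d → ℝ) → ℝ) :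
    nrm2 κ F ^ 2 = bk κ * ∫ x in Splx d, F x * F x * Wk κ x :=
  Real.sq_sqrt (mul_nonneg (bk_pos hκ).le
    (setIntegral_nonneg (isCompact_Splx d).measurableSet fun _ hx =>
      mul_nonneg (mul_self_nonneg _) (Wk_nonneg κ hx)))

open MvPolynomial in
lemma cform_eval {d : ℕ} {κ : Fin (d + 1) → ℝ} (hκ : ∀ i, 0 ≤ κ i)
    (f : MvPolynomial (Fin d) ℝ) :
    cform κ (fun x => eval x f) = bk κ * jacobiIntegral hκ (carreDuChamp f f) := by
  have hms := (isCompact_Splx d).measurableSet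
  have hWm : Measurable (Wk κ) := (continuous_Wk hκ).measurable
  have hem : ∀ p : MvPolynomial (Fin d) ℝ, Measurable fun x : Fin d → ℝ => eval x p :=
    fun p => (continuous_eval p).measurable
  set G : (Fin d → ℝ) → ℝ := fun x =>
    Real.sqrt ((1 - ∑ k, x k) / (∑ k, x k)) * xgrad (fun x => eval x f) x
  set H : Fin d → Fin d → (Fin d → ℝ) → ℝ := fun i j x =>
    Real.sqrt (x i * x j) / Real.sqrt (∑ k, x k) * pdd i j (fun x => eval x f) x
  have hGm : Measurable G := by
    simp only [G, xgrad, pd_eval]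
    fun_prop
  have hHm : ∀ i j, Measurable (H i j) := fun i j => by
    simp only [H, pdd, pd_eval]
    fun_prop
  have hr0 : ∀ x ∈ Splx d, 0 ≤ ∑ k, x k := fun x hx => Finset.sum_nonneg fun k _ => hx.1 k
  have hG : ∀ x ∈ Splx d, G x * G x =
      (1 - ∑ k, x k) / (∑ k, x k) * (∑ i, x i * eval x (pderiv i f)) ^ 2 := fun x hx => by
    have h := Real.mul_self_sqrt (div_nonneg (sub_nonneg.2 hx.2) (hr0 x hx))
    simp only [G, xgrad, pd_eval]
    rw [mul_mul_mul_comm, h, sq]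
  have hH : ∀ i j, ∀ x ∈ Splx d, H i j x * H i j x =
      x i * x j / (∑ k, x k) * (eval x (pderiv i f) - eval x (pderiv j f)) ^ 2 :=
    fun i j x hx => by
    have h := Real.mul_self_sqrt (mul_nonneg (hx.1 i) (hx.1 j))
    have h' := Real.mul_self_sqrt (hr0 x hx)
    simp only [H, pdd, pd_eval]
    rw [mul_mul_mul_comm, div_mul_div_comm, h, h', sq]
  have hle : ∀ x ∈ Splx d, ∀ j, x j / ∑ k, x k ≤ 1 := fun x hx j =>
    div_le_one_of_le₀ (Finset.single_le_sum (fun k _ => hx.1 k) (Finset.mem_univ j)) (hr0 x hx)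
  have hsum : ∀ x ∈ Splx d, G x * G x +
      ∑ i, ∑ j ∈ Finset.univ.filter (fun j => i < j), H i j x * H i j x =
        eval x (carreDuChamp f f) := fun x hx => by
    have hL := sum_sum_lt_mul_sq_sub x fun i => eval x (pderiv i f)
    simp only [hG x hx, hH _ _ x hx, carreDuChamp, map_sub, map_sum, map_mul, eval_X]
    obtain h0 | h0 := (hr0 x hx).eq_or_lt
    · have hx0 : ∀ i, x i = 0 := fun i =>
        (Finset.sum_eq_zero_iff_of_nonneg fun k _ => hx.1 k).1 h0.symm i (Finset.mem_univ i)
      simp [hx0]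
    · simp only [div_mul_eq_mul_div, ← Finset.sum_div, hL]
      field_simp
      ring
  have hHnonneg : ∀ x, 0 ≤ ∑ i, ∑ j ∈ Finset.univ.filter (fun j => i < j), H i j x * H i j x :=
    fun x => Finset.sum_nonneg fun i _ => Finset.sum_nonneg fun j _ => mul_self_nonneg _
  have hGi : IntegrableOn (fun x => G x * G x * Wk κ x) (Splx d) := by
    refine (integrableOn_eval_mul_Wk hκ (carreDuChamp f f)).mono'
      (by fun_prop) ?_
    filter_upwards [ae_restrict_mem hms] with x hx
    rw [Real.norm_of_nonneg (mul_nonneg (mul_self_nonneg _) (Wk_nonneg κ hx))]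
    refine mul_le_mul_of_nonneg_right ?_ (Wk_nonneg κ hx)
    linarith [hsum x hx, hHnonneg x]
  have hHi : ∀ i j, IntegrableOn (fun x => H i j x * H i j x * Wk κ x) (Splx d) := fun i j => by
    have hHij := hHm i j
    refine (integrableOn_eval_mul_Wk hκ (X i * (pderiv i f - pderiv j f) ^ 2)).mono'
      (by fun_prop) ?_
    filter_upwards [ae_restrict_mem hms] with x hx
    rw [Real.norm_of_nonneg (mul_nonneg (mul_self_nonneg _) (Wk_nonneg κ hx)), hH i j x hx,
      mul_div_assoc, eval_mul, eval_X, eval_pow, eval_sub]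
    exact mul_le_mul_of_nonneg_right (mul_le_mul_of_nonneg_right
      (mul_le_of_le_one_right (hx.1 i) (hle x hx j)) (sq_nonneg _)) (Wk_nonneg κ hx)
  change nrm2 κ G ^ 2 +
    ∑ i, ∑ j ∈ Finset.univ.filter (fun j => i < j), nrm2 κ (H i j) ^ 2 = _
  simp only [nrm2_sq hκ, ← Finset.mul_sum, ← mul_add]
  rw [jacobiIntegral_apply]
  congr 1
  have hcol : ∀ i, ∑ j ∈ Finset.univ.filter (fun j => i < j),
      ∫ x in Splx d, H i j x * H i j x * Wk κ x =
        ∫ x in Splx d, ∑ j ∈ Finset.univ.filter (fun j => i < j), H i j x * H i j x * Wk κ x :=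
    fun i => (integral_finsetSum _ fun j _ => hHi i j).symm
  rw [Finset.sum_congr rfl fun i _ => hcol i,
    ← integral_finsetSum _ fun i _ => integrable_finsetSum _ fun j _ => hHi i j,
    ← integral_add hGi (integrable_finsetSum _ fun i _ => integrable_finsetSum _ fun j _ => hHi i j)]
  refine setIntegral_congr_fun hms fun x hx => ?_
  simp only [← hsum x hx, add_mul, Finset.sum_mul]

/-- the inequality \eqref{eq:B-ineq1}, with equality iff `f ∈ V_n^d(W_κ)`. -/
theorem stmt11 (d : ℕ) (hd : 2 ≤ d) (κ : Fin (d+1) → ℝ) (hκ : ∀ i, 0 ≤ κ i)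
    (n : ℕ) (f : MvPolynomial (Fin d) ℝ) (hf : f.totalDegree ≤ n) :
    cform κ (fun x => MvPolynomial.eval x f) ≤
      (n : ℝ) * ((n : ℝ) + (∑ k, κ k) + (d : ℝ)) *
        nrm2 κ (fun x => MvPolynomial.eval x f) ^ 2 ∧
    (cform κ (fun x => MvPolynomial.eval x f) =
      (n : ℝ) * ((n : ℝ) + (∑ k, κ k) + (d : ℝ)) *
        nrm2 κ (fun x => MvPolynomial.eval x f) ^ 2 ↔ InVn d n κ f) := by
  have hipk : ∀ g : MvPolynomial (Fin d) ℝ,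
      ipk κ (fun x => MvPolynomial.eval x f) (fun x => MvPolynomial.eval x g) =
        bk κ * jacobiIntegral hκ (f * g) := fun g => by
    simp only [ipk, jacobiIntegral_apply, MvPolynomial.eval_mul]
  have hnrm : nrm2 κ (fun x => MvPolynomial.eval x f) ^ 2 = bk κ * jacobiIntegral hκ (f * f) := by
    rw [nrm2_sq hκ, ← hipk]
    rfl
  have hb := bk_pos hκ
  obtain ⟨hle, hiff⟩ := jacobiIntegral_mul_jacobiOperator_le hκ n hf
  rw [cform_eval hκ, ← jacobiIntegral_jacobiOperator_mul, mul_comm (jacobiOperator κ f), hnrm,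
    mul_left_comm, mul_le_mul_iff_right₀ hb, mul_right_inj' hb.ne', hiff]
  refine ⟨hle, fun h => ⟨hf, fun g hg => by rw [hipk, h g hg, mul_zero]⟩, fun h g hg => ?_⟩
  have h0 := h.2 g hg
  rw [hipk] at h0
  exact (mul_eq_zero.1 h0).resolve_left hb.ne'
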